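/- The duality relation for multiple zeta values: for any k ≥ 1 and p = (p₁,…,p_k), q = (q₁,…,q_k) ∈ ℤ₊^k, ζ(τ(p,q)) = ζ(τ(q*, p*)), where τ(p,q) := (1^{p₁-1}, q₁+1, …, 1^{p_k-1}, q_k+1), r* denotes the reversed tuple, and ζ(k₁,…,k_m) := Σ_{0<n₁<⋯<n_m} 1/(n₁^{k₁}⋯n_m^{k_m}). -/

import Mathlib

noncomputable section

/-- The multiple zeta value `ζ(k₁,…,k_m) = Σ_{0<n₁<⋯<n_m} n₁^{-k₁}⋯n_m^{-k_m}`. -/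
def mzv (ks : List ℕ) : ℝ :=
  ∑' n : {f : Fin ks.length → ℕ // StrictMono f ∧ ∀ i, 0 < f i},
    ∏ i, ((n.1 i : ℝ) ^ ks.get i)⁻¹

/-- `τ(p,q) = (1^{p₁-1}, q₁+1, …, 1^{p_k-1}, q_k+1)`. -/
def tau (p q : List ℕ) : List ℕ :=
  ((p.zip q).map (fun x => List.replicate (x.1 - 1) 1 ++ [x.2 + 1])).flatten

open scoped ENNReal
open Filter Topology

namespace MZVD

def C (n m : ℕ) : ℝ := (((n + m).choose n : ℕ) : ℝ)⁻¹

lemma C_pos (n m : ℕ) : 0 < C n m := by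
  unfold C
  have := Nat.choose_pos (Nat.le_add_right n m)
  positivity

lemma C_comm (n m : ℕ) : C n m = C m n := by
  unfold C
  rw [Nat.choose_symm_add, Nat.add_comm]

lemma C_step (n m : ℕ) (hm : 0 < m) :
    ((n : ℝ) + 1)⁻¹ * C (n + 1) m = (m : ℝ)⁻¹ * (C n m - C (n + 1) m) := by
  have h1 := Nat.add_one_mul_choose_eq (n + m) n
  have e : n + 1 + m = n + m + 1 := by ring
  have hp1 : (0 : ℝ) < ((n + m).choose n : ℕ) := by
    exact_mod_cast Nat.choose_pos (Nat.le_add_right n m)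
  have hp2 : (0 : ℝ) < ((n + m + 1).choose (n + 1) : ℕ) := by
    exact_mod_cast Nat.choose_pos (by omega)
  have h2 : ((n : ℝ) + m + 1) * ((n + m).choose n : ℕ) =
      ((n + m + 1).choose (n + 1) : ℕ) * ((n : ℝ) + 1) := by exact_mod_cast h1
  unfold C
  rw [e]
  have hm' : (0 : ℝ) < m := by exact_mod_cast hm
  have hn : (0 : ℝ) < (n : ℝ) + 1 := by positivity
  generalize (((n + m).choose n : ℕ) : ℝ) = x at *
  generalize (((n + m + 1).choose (n + 1) : ℕ) : ℝ) = y at *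
  field_simp
  linarith

lemma C_le (n m : ℕ) (hm : 0 < m) : C n m ≤ 1 / ((n : ℝ) + 1) := by
  unfold C
  rw [← one_div]
  apply one_div_le_one_div_of_le (by positivity)
  have : (n + 1).choose n ≤ (n + m).choose n := Nat.choose_le_choose n (by omega)
  rw [Nat.choose_succ_self_right] at this
  exact_mod_cast this

lemma C_tendsto (m : ℕ) (hm : 0 < m) : Tendsto (fun n => C n m) atTop (𝓝 0) :=
  squeeze_zero (fun n => (C_pos n m).le) (fun n => C_le n m hm)
    tendsto_one_div_add_atTop_nhds_zero_nat

lemma C_hasSum (n m : ℕ) (hm : 0 < m) :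
    HasSum (fun i : ℕ => (((n + i : ℕ) : ℝ) + 1)⁻¹ * C (n + i + 1) m) ((m : ℝ)⁻¹ * C n m) := by
  rw [hasSum_iff_tendsto_nat_of_nonneg]
  · have : ∀ N, ∑ i ∈ Finset.range N, (((n + i : ℕ) : ℝ) + 1)⁻¹ * C (n + i + 1) m
        = (m : ℝ)⁻¹ * (C n m - C (n + N) m) := by
      intro N
      induction N with
      | zero => simp
      | succ N ih =>
        rw [Finset.sum_range_succ, ih, C_step _ _ hm, ← add_assoc]
        ring
    simp_rw [this]
    have h := ((C_tendsto m hm).comp (tendsto_add_atTop_nat n))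
    have h2 := (h.const_sub (C n m)).const_mul ((m : ℝ)⁻¹)
    simpa [Function.comp_def, add_comm] using h2
  · intro i
    have := C_pos (n + i + 1) m
    positivity

def K (n m : ℕ) : ℝ≥0∞ := ENNReal.ofReal (C n m)

lemma K_comm (n m : ℕ) : K n m = K m n := by rw [K, C_comm, K]

lemma K_sum (n m : ℕ) (hm : 0 < m) :
    ∑' a : ℕ, (if n < a then (a : ℝ≥0∞)⁻¹ * K a m else 0) = (m : ℝ≥0∞)⁻¹ * K n m := by
  have h := C_hasSum n m hm
  have hinj : Function.Injective (fun i : ℕ => n + i + 1) := by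
    intro a b hab; simpa using hab
  rw [← hinj.tsum_eq]
  · have e : ∀ i : ℕ, (if n < n + i + 1 then ((n + i + 1 : ℕ) : ℝ≥0∞)⁻¹ * K (n + i + 1) m else 0)
        = ENNReal.ofReal ((((n + i : ℕ) : ℝ) + 1)⁻¹ * C (n + i + 1) m) := by
      intro i
      rw [if_pos (by omega), ENNReal.ofReal_mul (by positivity),
        ENNReal.ofReal_inv_of_pos (by positivity), K]
      congr 2
      rw [← Nat.cast_succ, ENNReal.ofReal_natCast]
    simp_rw [e]
    rw [← ENNReal.ofReal_tsum_of_nonneg _ h.summable, h.tsum_eq,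
      ENNReal.ofReal_mul (by positivity), ENNReal.ofReal_inv_of_pos (by exact_mod_cast hm),
      ENNReal.ofReal_natCast, K]
    intro i
    have := C_pos (n + i + 1) m
    positivity
  · intro a ha
    have : n < a := by
      by_contra hc
      simp [hc] at ha
    exact ⟨a - n - 1, by simp only; omega⟩

def U (f : ℕ → ℝ≥0∞) (n : ℕ) : ℝ≥0∞ := (n : ℝ≥0∞)⁻¹ * f n
def S (f : ℕ → ℝ≥0∞) (n : ℕ) : ℝ≥0∞ := (n : ℝ≥0∞)⁻¹ * ∑' j : ℕ, if j < n then f j else 0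
def pair (f g : ℕ → ℝ≥0∞) : ℝ≥0∞ := ∑' n, ∑' m, f n * g m * K n m

lemma pair_comm (f g : ℕ → ℝ≥0∞) : pair f g = pair g f := by
  unfold pair
  rw [ENNReal.tsum_comm]
  refine tsum_congr fun n => tsum_congr fun m => ?_
  rw [K_comm]; ring

lemma pair_S (f g : ℕ → ℝ≥0∞) (hg : g 0 = 0) : pair (S f) g = pair f (U g) := by
  unfold pair
  rw [ENNReal.tsum_comm]
  conv_rhs => rw [ENNReal.tsum_comm]
  refine tsum_congr fun m => ?_
  rcases Nat.eq_zero_or_pos m with rfl | hm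
  · simp [hg, U]
  have h1 : ∀ n, S f n * g m * K n m =
      ∑' j, g m * (f j * (if j < n then (n : ℝ≥0∞)⁻¹ * K n m else 0)) := by
    intro n
    rw [ENNReal.tsum_mul_left, S]
    have : ∑' j, f j * (if j < n then (n : ℝ≥0∞)⁻¹ * K n m else 0)
        = (∑' j, if j < n then f j else 0) * ((n : ℝ≥0∞)⁻¹ * K n m) := by
      rw [← ENNReal.tsum_mul_right]
      refine tsum_congr fun j => ?_
      split_ifs <;> simp
    rw [this]; ring
  simp_rw [h1]
  rw [ENNReal.tsum_comm]
  refine tsum_congr fun j => ?_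
  rw [ENNReal.tsum_mul_left, ENNReal.tsum_mul_left, K_sum j m hm, U]
  ring

lemma pair_U (f g : ℕ → ℝ≥0∞) (hf : f 0 = 0) : pair (U f) g = pair f (S g) := by
  rw [pair_comm, ← pair_S g f hf, pair_comm]

def d0 (n : ℕ) : ℝ≥0∞ := if n = 0 then 1 else 0

def ap : List Bool → (ℕ → ℝ≥0∞) → (ℕ → ℝ≥0∞)
  | [], f => f
  | true :: w, f => S (ap w f)
  | false :: w, f => U (ap w f)

lemma ap_append (u v : List Bool) (f : ℕ → ℝ≥0∞) : ap (u ++ v) f = ap u (ap v f) := by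
  induction u with
  | nil => rfl
  | cons a u ih => cases a <;> simp [ap, ih]

lemma ap_zero (u : List Bool) (f : ℕ → ℝ≥0∞) : ap (u ++ [true]) f 0 = 0 := by
  induction u with
  | nil => simp [ap, S]
  | cons a u ih => cases a <;> simp_all [ap, S, U]

lemma transfer (u : List Bool) : ∀ v : List Bool,
    pair (ap (u ++ [true]) d0) (ap (v ++ [true]) d0) =
    pair d0 (ap (((u ++ [true]).map not).reverse ++ (v ++ [true])) d0) := by
  induction u with
  | nil => intro v; simpa [ap] using pair_S d0 _ (ap_zero v d0)
  | cons a u ih =>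
    intro v
    cases a
    · have := ih (true :: v)
      simp only [List.cons_append, ap] at this ⊢
      rw [pair_U _ _ (ap_zero u d0), this]
      simp
    · have := ih (false :: v)
      simp only [List.cons_append, ap] at this ⊢
      rw [pair_S _ _ (ap_zero v d0), this]
      simp

lemma pair_d0 (g : ℕ → ℝ≥0∞) : pair d0 g = ∑' n, g n := by
  unfold pair
  rw [tsum_eq_single 0]
  · simp [d0, K, C]
  · intro n hn; simp [d0, hn]

lemma dual (u : List Bool) :
    ∑' n, ap (false :: (u ++ [true])) d0 n
      = ∑' n, ap ((false :: (u ++ [true])).map not).reverse d0 n := by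
  rw [← pair_d0, ← pair_d0, pair_comm]
  simp only [ap]
  rw [pair_U _ _ (ap_zero u d0)]
  have := transfer u []
  simp only [List.nil_append, ap] at this
  rw [this]
  simp

/-- word of an index, outermost letter first -/
def word : List ℕ → List Bool
  | [] => []
  | k :: ks => word ks ++ (List.replicate (k - 1) false ++ [true])

lemma word_append (a b : List ℕ) : word (a ++ b) = word b ++ word a := by
  induction a with
  | nil => simp [word]
  | cons k a ih => simp [word, ih]

lemma word_ones (n : ℕ) : word (List.replicate n 1) = List.replicate n true := by
  induction n with
  | zero => rfl
  | succ n ih => simp [List.replicate_succ, word, ih, ← List.replicate_succ']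

abbrev T (m a : ℕ) := {f : Fin m → ℕ // StrictMono f ∧ ∀ i, a < f i}

def H (ks : List ℕ) (a : ℕ) : ℝ≥0∞ :=
  ∑' n : T ks.length a, ∏ i, ((n.1 i : ℝ≥0∞) ^ ks.get i)⁻¹

def eT (m a : ℕ) : T (m + 1) a ≃ Σ b : {b : ℕ // a < b}, T m b where
  toFun f := ⟨⟨f.1 0, f.2.2 0⟩, ⟨fun i => f.1 i.succ,
    fun _ _ h => f.2.1 (Fin.succ_lt_succ_iff.2 h), fun i => f.2.1 (Fin.succ_pos i)⟩⟩
  invFun x := ⟨Fin.cons x.1.1 x.2.1, by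
    constructor
    · intro i j h
      induction i using Fin.cases with
      | zero =>
        induction j using Fin.cases with
        | zero => exact absurd h (lt_irrefl _)
        | succ j => simpa using x.2.2.2 j
      | succ i =>
        induction j using Fin.cases with
        | zero => exact absurd h (by simp)
        | succ j => simpa using x.2.2.1 (Fin.succ_lt_succ_iff.1 h)
    · intro i
      induction i using Fin.cases with
      | zero => simpa using x.1.2
      | succ i => simpa using x.1.2.trans (x.2.2.2 i)⟩
  left_inv f := by
    apply Subtype.ext
    funext i
    induction i using Fin.cases <;> simp
  right_inv x := by
    obtain ⟨⟨b, hb⟩, ⟨g, hg⟩⟩ := x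
    rfl

lemma H_nil (a : ℕ) : H [] a = 1 := by
  unfold H
  have : Unique (T ([] : List ℕ).length a) :=
    { default := ⟨fun i => i.elim0, fun i => i.elim0, fun i => i.elim0⟩
      uniq := fun f => Subtype.ext (funext fun i => i.elim0) }
  rw [tsum_eq_single (default : T ([] : List ℕ).length a)]
  · simp
  · intro b hb; exact absurd (Subsingleton.elim _ _) hb

lemma H_cons (k : ℕ) (ks : List ℕ) (a : ℕ) :
    H (k :: ks) a = ∑' b : ℕ, if a < b then ((b : ℝ≥0∞) ^ k)⁻¹ * H ks b else 0 := by
  have h1 : H (k :: ks) a = ∑' x : Σ b : {b : ℕ // a < b}, T ks.length b,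
      (((x.1.1 : ℕ) : ℝ≥0∞) ^ k)⁻¹ * ∏ i, ((x.2.1 i : ℝ≥0∞) ^ ks.get i)⁻¹ := by
    rw [← (eT ks.length a).tsum_eq]
    unfold H
    refine tsum_congr fun f => ?_
    exact Fin.prod_univ_succ (n := ks.length)
      (fun i => ((f.1 i : ℝ≥0∞) ^ (k :: ks).get i)⁻¹)
  rw [h1, ENNReal.tsum_sigma (fun (b : {b : ℕ // a < b}) (g : T ks.length b) =>
      (((b.1 : ℕ) : ℝ≥0∞) ^ k)⁻¹ * ∏ i, ((g.1 i : ℝ≥0∞) ^ ks.get i)⁻¹)]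
  simp_rw [ENNReal.tsum_mul_left]
  have h2 := tsum_subtype {b : ℕ | a < b} (fun b => ((b : ℝ≥0∞) ^ k)⁻¹ * H ks b)
  refine Eq.trans h2 (tsum_congr fun b => ?_)
  simp [Set.indicator]

lemma ap_U (j : ℕ) (f : ℕ → ℝ≥0∞) (n : ℕ) :
    ap (List.replicate j false) f n = ((n : ℝ≥0∞)⁻¹) ^ j * f n := by
  induction j with
  | zero => simp [ap]
  | succ j ih => simp only [List.replicate_succ, ap, U, ih]; ring

lemma H_ap (ks : List ℕ) : ∀ (_ : ∀ k ∈ ks, 0 < k) (f : ℕ → ℝ≥0∞),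
    ∑' n, f n * H ks n = ∑' n, ap (word ks) f n := by
  induction ks with
  | nil => intro _ f; simp [H_nil, word, ap]
  | cons k ks ih =>
    intro hk f
    rw [word, ap_append, ← ih (fun x hx => hk x (List.mem_cons_of_mem _ hx))]
    simp_rw [H_cons, ← ENNReal.tsum_mul_left]
    rw [ENNReal.tsum_comm]
    refine tsum_congr fun b => ?_
    obtain ⟨j, rfl⟩ : ∃ j, k = j + 1 := ⟨k - 1, by have := hk k (by simp); omega⟩
    rw [ap_append, ap_U]
    simp only [ap, S, Nat.add_sub_cancel]
    have : ∀ n, (f n * if n < b then ((b : ℝ≥0∞) ^ (j + 1))⁻¹ * H ks b else 0)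
        = (if n < b then f n else 0) * (((b : ℝ≥0∞) ^ (j + 1))⁻¹ * H ks b) := by
      intro n; split_ifs <;> simp
    simp_rw [this]
    rw [ENNReal.tsum_mul_right, ENNReal.inv_pow]
    ring

lemma mzv_eq (ks : List ℕ) (h : ∀ k ∈ ks, 0 < k) :
    mzv ks = (∑' n, ap (word ks) d0 n).toReal := by
  rw [← H_ap ks h, tsum_eq_single 0]
  · simp only [d0, if_true, one_mul]
    unfold H mzv
    rw [ENNReal.tsum_toReal_eq]
    · refine tsum_congr fun n => ?_
      rw [ENNReal.toReal_prod]
      simp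
    · intro n
      refine ENNReal.prod_ne_top fun i _ => ?_
      have := n.2.2 i
      simp
      intro h0
      omega
  · intro n hn; simp [d0, hn]

lemma tau_pos (p q : List ℕ) : ∀ k ∈ tau p q, 0 < k := by
  intro k hk
  simp only [tau, List.mem_flatten, List.mem_map] at hk
  obtain ⟨l, ⟨x, _, rfl⟩, hk⟩ := hk
  simp only [List.mem_append, List.mem_replicate, List.mem_singleton] at hk
  omega

def tw (z : List (ℕ × ℕ)) : List Bool :=
  (z.map (fun x => List.replicate x.2 false ++ List.replicate x.1 true)).flatten

lemma word_tau (z : List (ℕ × ℕ)) (hz : ∀ x ∈ z, 0 < x.1) :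
    word ((z.map (fun x => List.replicate (x.1 - 1) 1 ++ [x.2 + 1])).flatten) = tw z.reverse := by
  induction z with
  | nil => rfl
  | cons x z ih =>
    have hx := hz x (by simp)
    obtain ⟨j, hj⟩ : ∃ j, x.1 = j + 1 := ⟨x.1 - 1, by omega⟩
    have ih' := ih (fun y hy => hz y (List.mem_cons_of_mem _ hy))
    simp only [List.map_cons, List.flatten_cons, word_append, ih', word_ones, hj]
    simp [tw, word, hj, List.replicate_succ]

lemma tw_dual (z : List (ℕ × ℕ)) : ((tw z).map not).reverse = tw (z.map Prod.swap).reverse := by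
  induction z with
  | nil => rfl
  | cons x z ih =>
    have e : tw (x :: z) = (List.replicate x.2 false ++ List.replicate x.1 true) ++ tw z := by
      simp [tw]
    rw [e, List.map_append, List.reverse_append, ih]
    simp [tw]

end MZVD

open MZVD in
/-- The duality relation for multiple zeta values: `ζ(τ(p,q)) = ζ(τ(q*,p*))`. -/
theorem mzv_duality (p q : List ℕ) (hk : 0 < p.length) (hlen : p.length = q.length)
    (hp : ∀ x ∈ p, 0 < x) (hq : ∀ x ∈ q, 0 < x) :
    mzv (tau p q) = mzv (tau q.reverse p.reverse) := by
  rw [mzv_eq _ (tau_pos _ _), mzv_eq _ (tau_pos _ _)]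
  congr 1
  have hz : ∀ x ∈ p.zip q, 0 < x.1 ∧ 0 < x.2 := fun x hx =>
    ⟨hp _ (List.of_mem_zip (a := x.1) (b := x.2) hx).1,
      hq _ (List.of_mem_zip (a := x.1) (b := x.2) hx).2⟩
  have hrev : q.reverse.zip p.reverse = ((p.zip q).map Prod.swap).reverse := by
    rw [List.zip_swap]
    simp only [List.zip]
    rw [List.reverse_zipWith hlen.symm]
  unfold tau
  rw [hrev, word_tau _ (fun x hx => (hz x hx).1), word_tau _ (by
    intro x hx
    simp only [List.mem_reverse, List.mem_map] at hx
    obtain ⟨y, hy, rfl⟩ := hx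
    exact (hz y hy).2)]
  have hd := tw_dual (p.zip q).reverse
  rw [List.map_reverse] at hd
  rw [← hd]
  have hne : p.zip q ≠ [] := by
    intro h0
    have := congrArg List.length h0
    simp only [List.length_zip, List.length_nil] at this
    omega
  obtain ⟨u, hu⟩ : ∃ u, tw (p.zip q).reverse = false :: (u ++ [true]) := by
    generalize p.zip q = z at *
    have h1 : ∃ w, tw z.reverse = false :: w := by
      obtain ⟨z', x, rfl⟩ := List.eq_nil_or_concat z |>.resolve_left hne
      obtain ⟨j, hj⟩ : ∃ j, x.2 = j + 1 := ⟨x.2 - 1, by have := (hz x (by simp)).2; omega⟩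
      simp [tw, hj, List.replicate_succ]
    have h2 : ∃ w, tw z.reverse = w ++ [true] := by
      cases z with
      | nil => exact absurd rfl hne
      | cons x z =>
        obtain ⟨j, hj⟩ : ∃ j, x.1 = j + 1 := ⟨x.1 - 1, by have := (hz x (by simp)).1; omega⟩
        refine ⟨tw z.reverse ++ (List.replicate x.2 false ++ List.replicate j true), ?_⟩
        simp [tw, hj, List.replicate_succ']
    obtain ⟨w, hw⟩ := h1
    obtain ⟨v, hv⟩ := h2
    rw [hw] at hv
    cases v with
    | nil => simp at hv
    | cons a v =>
      simp only [List.cons_append, List.cons.injEq] at hv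
      exact ⟨v, by rw [hw, hv.2]⟩
  rw [hu]
  exact dual u
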